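/- Let u₁,u₂,u₃,v₁,v₂,v₃ ∈ ℂ. On ℂ[x₁,y₁,z₁,x₂,y₂,z₂], let Lᵢ(a₁,a₂,a₃) (i = 1,2) be the sl(3) Lax matrix in the variables xᵢ,yᵢ,zᵢ, i.e. the 3×3 matrix of operators with entries L₁₁ = xᵢ∂_{xᵢ}+yᵢ∂_{yᵢ}+a₁+2, L₁₂ = ∂_{xᵢ}, L₁₃ = ∂_{yᵢ}, L₂₁ = −xᵢ²∂_{xᵢ}−xᵢyᵢ∂_{yᵢ}+(xᵢzᵢ+yᵢ)∂_{zᵢ}+(a₂−a₁−1)xᵢ, L₂₂ = −xᵢ∂_{xᵢ}+zᵢ∂_{zᵢ}+a₂+1, L₂₃ = ∂_{zᵢ}−xᵢ∂_{yᵢ}, L₃₁ = −xᵢyᵢ∂_{xᵢ}−yᵢ²∂_{yᵢ}−zᵢ(xᵢzᵢ+yᵢ)∂_{zᵢ}+(a₃−a₂−1)xᵢzᵢ+(a₃−a₁−2)yᵢ, L₃₂ = −yᵢ∂_{xᵢ}−zᵢ²∂_{zᵢ}+(a₃−a₂−1)zᵢ, L₃₃ = −yᵢ∂_{yᵢ}−zᵢ∂_{zᵢ}+a₃.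 Suppose R is a ℂ-linear endomorphism of ℂ[x₁,y₁,z₁,x₂,y₂,z₂] that commutes with multiplication by x₂, by y₂ and by z₂, commutes with the operator ∂_{x₁} − z₂∂_{y₁}, and satisfies R (L₁(u₁,u₂,u₃) + L₂(v₁,v₂,v₃)) = (L₁(u₁,u₂,v₃) + L₂(v₁,v₂,u₃)) R as 3×3 matrices of operators. Then R satisfies the second-order defining equation R L₁(u₁,u₂,u₃) L₂(v₁,v₂,v₃) = L₁(u₁,u₂,v₃) L₂(v₁,v₂,u₃) R. -/

import Mathlib

open MvPolynomial

/-- The endomorphism ring of `ℂ[x₁,y₁,z₁,x₂,y₂,z₂]`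
(variables `x₁ = X 0`, `y₁ = X 1`, `z₁ = X 2`, `x₂ = X 3`, `y₂ = X 4`, `z₂ = X 5`). -/
abbrev E6 : Type := Module.End ℂ (MvPolynomial (Fin 6) ℂ)

/-- Multiplication operators by the variables. -/
noncomputable def Zm (i : Fin 6) : E6 := LinearMap.mulLeft ℂ (X i)

/-- Partial derivatives. -/
noncomputable def Dm (i : Fin 6) : E6 := (pderiv i).toLinearMap

/-- The `sl(3)` Lax matrix `L(a₁,a₂,a₃)` in the variables indexed by `ix, iy, iz`. -/
noncomputable def Lax6 (ix iy iz : Fin 6) (a₁ a₂ a₃ : ℂ) : Matrix (Fin 3) (Fin 3) E6 :=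
  !![Zm ix * Dm ix + Zm iy * Dm iy + (a₁ + 2) • 1, Dm ix, Dm iy;
     -(Zm ix * Zm ix * Dm ix) - Zm ix * Zm iy * Dm iy + (Zm ix * Zm iz + Zm iy) * Dm iz
         + (a₂ - a₁ - 1) • Zm ix,
       -(Zm ix * Dm ix) + Zm iz * Dm iz + (a₂ + 1) • 1,
       Dm iz - Zm ix * Dm iy;
     -(Zm ix * Zm iy * Dm ix) - Zm iy * Zm iy * Dm iy - Zm iz * (Zm ix * Zm iz + Zm iy) * Dm iz
         + (a₃ - a₂ - 1) • (Zm ix * Zm iz) + (a₃ - a₁ - 2) • Zm iy,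
       -(Zm iy * Dm ix) - Zm iz * Zm iz * Dm iz + (a₃ - a₂ - 1) • Zm iz,
       -(Zm iy * Dm iy) - Zm iz * Dm iz + a₃ • 1]

/-- The scalar 3×3 matrix `R·Id`. -/
noncomputable def SM3 (R : E6) : Matrix (Fin 3) (Fin 3) E6 := Matrix.scalar (Fin 3) R

/-- The polynomial ring `ℂ[x₁,y₁,z₁,x₂,y₂,z₂]`. -/
abbrev P6 : Type := MvPolynomial (Fin 6) ℂ

theorem pderiv_pderiv_comm (i j : Fin 6) (p : P6) :
    pderiv i (pderiv j p) = pderiv j (pderiv i p) := by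
  let d (k : Fin 6) : Derivation ℂ (P6) (P6) := pderiv k
  have h : ⁅d i, d j⁆ = 0 := by
    apply MvPolynomial.derivation_ext
    intro k
    rw [Derivation.commutator_apply]
    simp only [d, pderiv_X, Pi.single_apply]
    split_ifs <;> simp
  have := congrArg (fun d => d p) h
  simpa [d, Derivation.commutator_apply, sub_eq_zero] using this

theorem coeff_X_mul_pderiv (i : Fin 6) (m : Fin 6 →₀ ℕ) (p : P6) :
    coeff m (X i * pderiv i p) = m i * coeff m p := by
  induction p using MvPolynomial.induction_on' with
  | add p q hp hq => simp [hp, hq, mul_add]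
  | monomial u a =>
    rw [X_mul_pderiv_monomial, coeff_smul, coeff_monomial]
    split_ifs with h
    · simp [h]
    · simp

/-- The Euler operator `z₁∂_{z₁}` has no negative integer eigenvalue. -/
theorem eq_zero_of_X_mul_pderiv (g : P6) (t : ℂ) (ht : ∀ k : ℕ, (k : ℂ) ≠ t)
    (h : X 2 * pderiv 2 g = C t * g) : g = 0 := by
  ext m
  have h1 := congrArg (coeff m) h
  rw [coeff_X_mul_pderiv, coeff_C_mul, ← sub_eq_zero, ← sub_mul, mul_eq_zero, sub_eq_zero] at h1
  rw [coeff_zero]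
  exact h1.resolve_left (ht _)

/-- The restriction of a polynomial to the hyperplane `x₁ = 0`. -/
noncomputable def restr : P6 →ₐ[ℂ] P6 :=
  aeval (fun i => if i = 0 then 0 else X i)

theorem restr_X_zero : restr (X 0) = 0 := by simp [restr]

theorem restr_X (i : Fin 6) (hi : i ≠ 0) : restr (X i) = X i := by simp [restr, hi]

theorem restr_C (a : ℂ) : restr (C a) = C a := by simp [restr]

theorem restr_pderiv (i : Fin 6) (hi : i ≠ 0) (p : P6) :
    restr (pderiv i p) = pderiv i (restr p) := by
  induction p using MvPolynomial.induction_on with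
  | C a => simp [restr]
  | add p q hp hq => simp [hp, hq]
  | mul_X p j hp =>
    simp only [Derivation.leibniz, smul_eq_mul, map_add, map_mul, hp]
    by_cases hj : j = 0
    · subst hj
      simp [restr, pderiv_X, hi]
    · by_cases hij : j = i <;> simp [restr, hj, pderiv_X, hij, hi]

theorem coeff_restr (m : Fin 6 →₀ ℕ) (hm : m 0 = 0) (p : P6) :
    coeff m (restr p) = coeff m p := by
  induction p using MvPolynomial.induction_on' with
  | add p q hp hq => simp [hp, hq]
  | monomial u a =>
    rw [restr, aeval_monomial]
    by_cases hu : u 0 = 0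
    · rw [monomial_eq, Finsupp.prod, Finsupp.prod, algebraMap_eq]
      congr 2
      apply Finset.prod_congr rfl
      intro i hi
      rw [if_neg]
      rintro rfl
      simp [hu] at hi
    · rw [coeff_monomial, if_neg (by rintro rfl; exact hu hm), Finsupp.prod,
        Finset.prod_eq_zero (i := 0) (by simpa using hu) (by simp [hu])]
      simp

theorem eq_zero_of_restr_of_pderiv (p : P6) (h : restr p = 0)
    (hp : pderiv 0 p = 0) : p = 0 := by
  ext m
  rw [coeff_zero]
  by_cases hm : m 0 = 0
  · rw [← coeff_restr m hm, h, coeff_zero]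
  · have h0 := coeff_X_mul_pderiv 0 m p
    rw [hp, mul_zero, coeff_zero, eq_comm, mul_eq_zero] at h0
    exact h0.resolve_left (Nat.cast_ne_zero.2 hm)

theorem Zm_apply (i : Fin 6) (p : P6) : Zm i p = X i * p := rfl

theorem Dm_apply (i : Fin 6) (p : P6) : Dm i p = pderiv i p := rfl

/-- The unipotent matrix that triangularises the second Lax matrix. -/
noncomputable def frame : Matrix (Fin 3) (Fin 3) E6 :=
  !![1, 0, 0; -Zm 3, 1, 0; -Zm 4, -Zm 5, 1]

/-- The inverse of `frame`. -/
noncomputable def frameInv : Matrix (Fin 3) (Fin 3) E6 :=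
  !![1, 0, 0; Zm 3, 1, 0; Zm 3 * Zm 5 + Zm 4, Zm 5, 1]

theorem C_two : (C 2 : P6) = 2 := map_ofNat C 2

theorem frame_mul_frameInv : frame * frameInv = 1 := by
  ext i j : 1
  fin_cases i <;> fin_cases j <;> refine LinearMap.ext fun p => ?_
  all_goals simp [frame, frameInv, Matrix.mul_apply, Fin.sum_univ_three, Zm_apply]
  ring

theorem frameInv_mul_frame : frameInv * frame = 1 := by
  ext i j : 1
  fin_cases i <;> fin_cases j <;> refine LinearMap.ext fun p => ?_
  all_goals simp [frame, frameInv, Matrix.mul_apply, Fin.sum_univ_three, Zm_apply]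
  ring

/-- The triangular form of the second Lax matrix. -/
noncomputable def laxTri (a₁ a₂ a₃ : ℂ) : Matrix (Fin 3) (Fin 3) E6 :=
  !![a₁ • 1, Dm 3 - Zm 5 * Dm 4, Dm 4; 0, a₂ • 1, Dm 5; 0, 0, a₃ • 1]

theorem frameInv_mul_lax_mul_frame (a₁ a₂ a₃ : ℂ) :
    frameInv * Lax6 3 4 5 a₁ a₂ a₃ * frame = laxTri a₁ a₂ a₃ := by
  ext i j : 1
  fin_cases i <;> fin_cases j <;> refine LinearMap.ext fun p => ?_
  all_goals
    simp [frame, frameInv, Lax6, laxTri, Matrix.mul_apply, Fin.sum_univ_three,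
      Zm_apply, Dm_apply, pderiv_X, smul_eq_C_mul, C_two] <;> ring

/-- The change of variables to coordinates relative to the second point. -/
noncomputable def shift : P6 ≃ₐ[ℂ] P6 :=
  AlgEquiv.ofAlgHom
    (aeval ![X 0 - X 3, X 1 - X 4 + X 5 * (X 0 - X 3), X 2 - X 5, X 3, X 4, X 5])
    (aeval ![X 0 + X 3, X 1 + X 4 - X 5 * X 0, X 2 + X 5, X 3, X 4, X 5])
    (by ext i : 1; fin_cases i <;> simp; ring)
    (by ext i : 1; fin_cases i <;> simp; ring)

theorem shift_X (i : Fin 6) : shift (X i) =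
    (![X 0 - X 3, X 1 - X 4 + X 5 * (X 0 - X 3), X 2 - X 5, X 3, X 4, X 5] :
      Fin 6 → P6) i := by
  simp [shift]

/-- Conjugation of operators by `shift`. -/
noncomputable def shiftConj : E6 ≃ₐ[ℂ] E6 := shift.toLinearEquiv.conjAlgEquiv ℂ

theorem shiftConj_apply_shift (A : E6) (p : P6) :
    shiftConj A (shift p) = shift (A p) := by
  simp [shiftConj]

theorem shiftConj_Zm (i : Fin 6) : shiftConj (Zm i) = LinearMap.mulLeft ℂ (shift (X i)) := by
  refine LinearMap.ext fun p => ?_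
  obtain ⟨p, rfl⟩ := shift.surjective p
  simp [shiftConj_apply_shift, Zm_apply]

theorem shift_pderiv (i : Fin 6) (d : Derivation ℂ (P6) (P6))
    (h : ∀ j, shift (pderiv i (X j)) = d (shift (X j))) (p : P6) :
    shift (pderiv i p) = d (shift p) := by
  induction p using MvPolynomial.induction_on with
  | C a => rw [show shift (C a) = C a from shift.commutes a]; simp [← algebraMap_eq]
  | add p q hp hq => simp [hp, hq]
  | mul_X p j hp =>
    simp only [Derivation.leibniz, smul_eq_mul, map_add, map_mul, hp, h]

theorem shiftConj_Dm_zero : shiftConj (Dm 0) = Dm 0 - Zm 5 * Dm 1 := by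
  refine LinearMap.ext fun p => ?_
  obtain ⟨p, rfl⟩ := shift.surjective p
  rw [shiftConj_apply_shift, Dm_apply, shift_pderiv 0 (pderiv 0 - (X 5 : P6) • pderiv 1)]
  · rfl
  · intro j
    fin_cases j <;> simp [shift_X, pderiv_X]

theorem shiftConj_Dm (i : Fin 6) (hi : i = 1 ∨ i = 2) : shiftConj (Dm i) = Dm i := by
  refine LinearMap.ext fun p => ?_
  obtain ⟨p, rfl⟩ := shift.surjective p
  rw [shiftConj_apply_shift, Dm_apply, shift_pderiv i (pderiv i)]
  · rfl
  · intro j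
    rcases hi with rfl | rfl <;> fin_cases j <;> simp [shift_X, pderiv_X]

theorem frameInv_mul_lax_mul_frame_first (a₁ a₂ a₃ : ℂ) :
    frameInv * Lax6 0 1 2 a₁ a₂ a₃ * frame = (Lax6 0 1 2 a₁ a₂ a₃).map shiftConj := by
  ext i j : 1
  fin_cases i <;> fin_cases j <;> refine LinearMap.ext fun p => ?_
  all_goals
    simp [frame, frameInv, Lax6, Matrix.mul_apply, Fin.sum_univ_three, shiftConj_Zm, shift_X,
      shiftConj_Dm_zero, shiftConj_Dm,
      Zm_apply, Dm_apply, pderiv_X, smul_eq_C_mul, C_two] <;> ring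

/-- The monomial `x₁ᵃ y₁ᵇ z₁ᶜ`. -/
noncomputable def mono (a b c : ℕ) : P6 := X 0 ^ a * X 1 ^ b * X 2 ^ c

theorem X_zero_mul_mono (a b c : ℕ) : X 0 * mono a b c = mono (a + 1) b c := by
  unfold mono; ring

theorem X_one_mul_mono (a b c : ℕ) : X 1 * mono a b c = mono a (b + 1) c := by
  unfold mono; ring

theorem X_two_mul_mono (a b c : ℕ) : X 2 * mono a b c = mono a b (c + 1) := by
  unfold mono; ring

theorem pderiv_zero_mono (a b c : ℕ) : pderiv 0 (mono a b c) = (a : P6) * mono (a - 1) b c := by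
  simp [mono, pderiv_X]; ring

theorem pderiv_one_mono (a b c : ℕ) : pderiv 1 (mono a b c) = (b : P6) * mono a (b - 1) c := by
  simp [mono, pderiv_X]; ring

theorem pderiv_two_mono (a b c : ℕ) : pderiv 2 (mono a b c) = (c : P6) * mono a b (c - 1) := by
  simp [mono, pderiv_X]; ring

theorem X_mul_pderiv_zero_mono (a b c : ℕ) :
    X 0 * pderiv 0 (mono a b c) = (a : P6) * mono a b c := by
  rw [pderiv_zero_mono]
  cases a <;> simp [mono]; ring

theorem X_mul_pderiv_one_mono (a b c : ℕ) :
    X 1 * pderiv 1 (mono a b c) = (b : P6) * mono a b c := by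
  rw [pderiv_one_mono]
  cases b <;> simp [mono]; ring

theorem X_mul_pderiv_two_mono (a b c : ℕ) :
    X 2 * pderiv 2 (mono a b c) = (c : P6) * mono a b c := by
  rw [pderiv_two_mono]
  cases c <;> simp [mono]; ring

theorem map_C_mul (A : E6) (t : ℂ) (p : P6) : A (C t * p) = C t * A p := by
  rw [← smul_eq_C_mul, map_smul, smul_eq_C_mul]

theorem lax_zero_zero_mono (u₁ u₂ u₃ : ℂ) (a b c : ℕ) :
    Lax6 0 1 2 u₁ u₂ u₃ 0 0 (mono a b c) = C (a + b + u₁ + 2) * mono a b c := by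
  simp [Lax6, Zm_apply, Dm_apply, smul_eq_C_mul, C_two]
  linear_combination X_mul_pderiv_zero_mono a b c + X_mul_pderiv_one_mono a b c

theorem lax_one_one_mono (u₁ u₂ u₃ : ℂ) (a b c : ℕ) :
    Lax6 0 1 2 u₁ u₂ u₃ 1 1 (mono a b c) = C (c - a + u₂ + 1) * mono a b c := by
  simp [Lax6, Zm_apply, Dm_apply, smul_eq_C_mul]
  linear_combination (-1 : P6) * X_mul_pderiv_zero_mono a b c + X_mul_pderiv_two_mono a b c

theorem lax_one_zero_mono (u₁ u₂ u₃ : ℂ) (a b c : ℕ) :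
    Lax6 0 1 2 u₁ u₂ u₃ 1 0 (mono a b c) =
      C (u₂ - u₁ - 1 - a - b + c) * mono (a + 1) b c + C (c : ℂ) * mono a (b + 1) (c - 1) := by
  simp [Lax6, Zm_apply, Dm_apply, smul_eq_C_mul, ← X_one_mul_mono, ← X_zero_mul_mono]
  linear_combination (-1 : P6) * X 0 * X_mul_pderiv_zero_mono a b c
    - X 0 * X_mul_pderiv_one_mono a b c
    + X 0 * X_mul_pderiv_two_mono a b c + X 1 * pderiv_two_mono a b c

theorem lax_two_one_mono (u₁ u₂ u₃ : ℂ) (a b c : ℕ) :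
    Lax6 0 1 2 u₁ u₂ u₃ 2 1 (mono a b c) =
      C (u₃ - u₂ - 1 - c) * mono a b (c + 1) + C (-a : ℂ) * mono (a - 1) (b + 1) c := by
  simp [Lax6, Zm_apply, Dm_apply, smul_eq_C_mul, ← X_one_mul_mono, ← X_two_mul_mono]
  linear_combination (-1 : P6) * X 1 * pderiv_zero_mono a b c - X 2 * X_mul_pderiv_two_mono a b c

theorem lax_two_zero_mono (u₁ u₂ u₃ : ℂ) (a b c : ℕ) :
    Lax6 0 1 2 u₁ u₂ u₃ 2 0 (mono a b c) =
      C (u₃ - u₂ - 1 - c) * mono (a + 1) b (c + 1)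
        + C (u₃ - u₁ - 2 - a - b - c) * mono a (b + 1) c := by
  simp [Lax6, Zm_apply, Dm_apply, smul_eq_C_mul, C_two, ← X_one_mul_mono, ← X_two_mul_mono,
    ← X_zero_mul_mono]
  linear_combination (-1 : P6) * X 1 * X_mul_pderiv_zero_mono a b c
    - X 1 * X_mul_pderiv_one_mono a b c
    - (X 0 * X 2 + X 1) * X_mul_pderiv_two_mono a b c

theorem restr_lax_zero_zero (u₁ u₂ u₃ : ℂ) (g : P6) :
    restr (Lax6 0 1 2 u₁ u₂ u₃ 0 0 g) = X 1 * pderiv 1 (restr g) + C (u₁ + 2) * restr g := by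
  simp [Lax6, Zm_apply, Dm_apply, smul_eq_C_mul, restr_X_zero, restr_X, restr_pderiv]

theorem restr_lax_one_one (u₁ u₂ u₃ : ℂ) (g : P6) :
    restr (Lax6 0 1 2 u₁ u₂ u₃ 1 1 g) = X 2 * pderiv 2 (restr g) + C (u₂ + 1) * restr g := by
  simp [Lax6, Zm_apply, Dm_apply, smul_eq_C_mul, restr_X_zero, restr_X, restr_pderiv]

theorem restr_lax_one_zero (u₁ u₂ u₃ : ℂ) (g : P6) :
    restr (Lax6 0 1 2 u₁ u₂ u₃ 1 0 g) = X 1 * pderiv 2 (restr g) := by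
  simp [Lax6, Zm_apply, Dm_apply, smul_eq_C_mul, restr_X_zero, restr_X, restr_pderiv]

theorem restr_lax_two_one (u₁ u₂ u₃ : ℂ) (g : P6) :
    restr (Lax6 0 1 2 u₁ u₂ u₃ 2 1 g) = C (u₃ - u₂ - 1) * (X 2 * restr g)
      - X 1 * restr (pderiv 0 g) - X 2 * (X 2 * pderiv 2 (restr g)) := by
  simp [Lax6, Zm_apply, Dm_apply, smul_eq_C_mul, restr_X, restr_pderiv]
  ring

theorem restr_lax_two_zero (u₁ u₂ u₃ : ℂ) (g : P6) :
    restr (Lax6 0 1 2 u₁ u₂ u₃ 2 0 g) = C (u₃ - u₁ - 2) * (X 1 * restr g)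
      - X 1 * (X 1 * pderiv 1 (restr g)) - X 1 * (X 2 * pderiv 2 (restr g)) := by
  simp [Lax6, Zm_apply, Dm_apply, smul_eq_C_mul, restr_X_zero, restr_X, restr_pderiv]
  ring

/-- The first two columns of `L₁` are intertwined by `R`. -/
def Intertwines (u₁ u₂ u₃ v₃ : ℂ) (R : E6) : Prop :=
  ∀ i j, j ≠ 2 → R * Lax6 0 1 2 u₁ u₂ u₃ i j = Lax6 0 1 2 u₁ u₂ v₃ i j * R

theorem Intertwines.apply {u₁ u₂ u₃ v₃ : ℂ} {R : E6} (hR : Intertwines u₁ u₂ u₃ v₃ R)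
    (i j : Fin 3) (hj : j ≠ 2) (p : P6) :
    R (Lax6 0 1 2 u₁ u₂ u₃ i j p) = Lax6 0 1 2 u₁ u₂ v₃ i j (R p) :=
  LinearMap.congr_fun (hR i j hj) p

theorem Intertwines.pderiv_zero {u₁ u₂ u₃ v₃ : ℂ} {R : E6} (hR : Intertwines u₁ u₂ u₃ v₃ R)
    (p : P6) : R (pderiv 0 p) = pderiv 0 (R p) :=
  hR.apply 0 1 (by decide) p

/-- The restriction to `x₁ = 0` of the image under `R` of a monomial. -/
noncomputable def sym (R : E6) (a b c : ℕ) : P6 := restr (R (mono a b c))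

section sym

variable {u₁ u₂ u₃ v₃ : ℂ} {R : E6}

theorem Intertwines.restr_pderiv_zero (a b c : ℕ) (hR : Intertwines u₁ u₂ u₃ v₃ R) :
    restr (pderiv 0 (R (mono a b c))) = (a : P6) * sym R (a - 1) b c := by
  rw [← hR.pderiv_zero, pderiv_zero_mono, ← map_natCast C, map_C_mul, map_mul, restr_C, sym]

theorem Intertwines.X_mul_pderiv_one (a b c : ℕ) (hR : Intertwines u₁ u₂ u₃ v₃ R) :
    X 1 * pderiv 1 (sym R a b c) = C (a + b : ℂ) * sym R a b c := by
  have h := congrArg restr (hR.apply 0 0 (by decide) (mono a b c))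
  rw [lax_zero_zero_mono, restr_lax_zero_zero, map_C_mul, map_mul, restr_C] at h
  change _ * sym R a b c = _ * pderiv 1 (sym R a b c) + _ * sym R a b c at h
  simp only [map_add, map_natCast, C_two] at h ⊢
  linear_combination -h

theorem Intertwines.X_mul_pderiv_two (a b c : ℕ) (hR : Intertwines u₁ u₂ u₃ v₃ R) :
    X 2 * pderiv 2 (sym R a b c) = C (c - a : ℂ) * sym R a b c := by
  have h := congrArg restr (hR.apply 1 1 (by decide) (mono a b c))
  rw [lax_one_one_mono, restr_lax_one_one, map_C_mul, map_mul, restr_C] at h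
  change _ * sym R a b c = _ * pderiv 2 (sym R a b c) + _ * sym R a b c at h
  simp only [map_add, map_sub, map_one, map_natCast] at h ⊢
  linear_combination -h

theorem Intertwines.sym_eq_zero (a b c : ℕ) (hac : c < a) (hR : Intertwines u₁ u₂ u₃ v₃ R) :
    sym R a b c = 0 := by
  refine eq_zero_of_X_mul_pderiv _ (c - a) (fun k hk => ?_) ?_
  · have : k + a = c := by
      have : ((k + a : ℕ) : ℂ) = c := by push_cast; linear_combination hk
      exact_mod_cast this
    omega
  · simpa using hR.X_mul_pderiv_two a b c

theorem Intertwines.sym_lower (a c : ℕ) (hR : Intertwines u₁ u₂ u₃ v₃ R) :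
    C (u₂ - u₁ - 1 - a + (c + 1)) * (X 2 * sym R (a + 1) 0 (c + 1))
      + C (c + 1 : ℂ) * (X 2 * sym R a 1 c) = C (c + 1 - a : ℂ) * (X 1 * sym R a 0 (c + 1)) := by
  have h := congrArg restr (hR.apply 1 0 (by decide) (mono a 0 (c + 1)))
  rw [lax_one_zero_mono, restr_lax_one_zero, map_add, map_C_mul, map_C_mul, map_add, map_mul,
    map_mul, restr_C, restr_C] at h
  change _ * sym R (a + 1) 0 (c + 1) + _ * sym R a 1 c = _ * pderiv 2 (sym R a 0 (c + 1)) at h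
  have h2 := hR.X_mul_pderiv_two a 0 (c + 1)
  simp only [map_add, map_sub, map_one, map_natCast, Nat.cast_add, Nat.cast_one, Nat.cast_zero,
    sub_zero] at h h2 ⊢
  linear_combination X 2 * h + X 1 * h2

theorem Intertwines.sym_two_one (a c : ℕ) (hR : Intertwines u₁ u₂ u₃ v₃ R) :
    C (u₃ - u₂ - 1 - c) * sym R a 0 (c + 1) - C (a : ℂ) * sym R (a - 1) 1 c =
      C (v₃ - u₂ - 1 - (c - a)) * (X 2 * sym R a 0 c) - C (a : ℂ) * (X 1 * sym R (a - 1) 0 c) := by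
  have h := congrArg restr (hR.apply 2 1 (by decide) (mono a 0 c))
  rw [lax_two_one_mono, restr_lax_two_one, map_add, map_C_mul, map_C_mul, map_add, map_mul,
    map_mul, restr_C, restr_C, hR.restr_pderiv_zero] at h
  change _ * sym R a 0 (c + 1) + _ * sym R (a - 1) 1 c = _ * (_ * sym R a 0 c) - _
    - _ * (_ * pderiv 2 (sym R a 0 c)) at h
  rw [hR.X_mul_pderiv_two] at h
  simp only [map_sub, map_one, map_natCast, map_neg] at h ⊢
  linear_combination h

theorem Intertwines.sym_two_zero (a c : ℕ) (hR : Intertwines u₁ u₂ u₃ v₃ R) :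
    C (u₃ - u₂ - 1 - c) * sym R (a + 1) 0 (c + 1)
      + C (u₃ - u₁ - 2 - a - c) * sym R a 1 c =
      C (v₃ - u₁ - 2 - c) * (X 1 * sym R a 0 c) := by
  have h := congrArg restr (hR.apply 2 0 (by decide) (mono a 0 c))
  rw [lax_two_zero_mono, restr_lax_two_zero, map_add, map_C_mul, map_C_mul, map_add, map_mul,
    map_mul, restr_C, restr_C] at h
  change _ * sym R (a + 1) 0 (c + 1) + _ * sym R a 1 c = _ * (_ * sym R a 0 c)
    - _ * (_ * pderiv 1 (sym R a 0 c)) - _ * (_ * pderiv 2 (sym R a 0 c)) at h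
  rw [hR.X_mul_pderiv_two, hR.X_mul_pderiv_one] at h
  simp only [map_sub, map_one, map_natCast, Nat.cast_zero, C_two, map_add, map_zero] at h ⊢
  linear_combination h

/-- The obstruction to the first row of the second-order relation. -/
noncomputable def defect (u₁ u₃ : ℂ) (R : E6) (a c : ℕ) : P6 :=
  C (a + 1 + u₁ - u₃) * (X 2 * sym R (a + 1) 0 (c + 1))
    + C (c + 1 - a : ℂ) * (X 1 * sym R a 0 (c + 1)) - C (c + 1 : ℂ) * (X 1 * (X 2 * sym R a 0 c))

theorem Intertwines.defect_recursion (a c : ℕ) (hR : Intertwines u₁ u₂ u₃ v₃ R) :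
    C (u₂ - u₁ - 1 - (a + 1)) * (X 2 * defect u₁ u₃ R (a + 1) c)
      + C (a + 1 : ℂ) * (X 1 * defect u₁ u₃ R a c) = 0 := by
  have h1 := hR.sym_lower a c
  have h2 := hR.sym_lower (a + 1) c
  have h3 := hR.sym_two_one (a + 1) c
  have h4 := hR.sym_two_zero (a + 1) c
  simp only [Nat.cast_add, Nat.cast_one, Nat.add_sub_cancel] at h1 h2 h3 h4
  simp only [defect, Nat.cast_add, Nat.cast_one]
  simp only [map_add, map_sub, map_one, map_natCast, C_two] at *
  linear_combination
    X 2 * ((c + 1 : P6) * X 2 * h4 - ((C u₃ : P6) - C u₁ - 2 - ((a : P6) + 1) - (c : P6)) * h2)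
      - X 1 * ((c + 1 : P6) * X 2 * h3 + (a + 1 : P6) * h1)

theorem Intertwines.defect_eq_zero (c : ℕ) (hR : Intertwines u₁ u₂ u₃ v₃ R) (a : ℕ) :
    defect u₁ u₃ R a c = 0 := by
  suffices ∀ k a, a + k = c + 1 → defect u₁ u₃ R a c = 0 by
    by_cases h : a ≤ c + 1
    · exact this (c + 1 - a) a (by omega)
    · simp [defect, hR.sym_eq_zero (a + 1) 0 (c + 1) (by omega),
        hR.sym_eq_zero a 0 (c + 1) (by omega), hR.sym_eq_zero a 0 c (by omega)]
  intro k
  induction k with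
  | zero =>
    rintro a rfl
    simp [defect, hR.sym_eq_zero (c + 1 + 1) 0 (c + 1) (by omega),
        hR.sym_eq_zero (c + 1) 0 c (by omega)]
  | succ k ih =>
    intro a ha
    have h := hR.defect_recursion a c
    rw [ih (a + 1) (by omega), mul_zero, mul_zero, zero_add] at h
    exact ((mul_eq_zero.1 ((mul_eq_zero.1 h).resolve_left
      (C_ne_zero.2 (Nat.cast_add_one_ne_zero a)))).resolve_left
      (X_ne_zero 1))

end sym

/-- The entry in row `i` of the second-order relation in the variables of the first point, with
spectral parameter `s`. -/
noncomputable def quad (u₁ u₂ u₃ s : ℂ) (i : Fin 3) : E6 :=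
  Lax6 0 1 2 u₁ u₂ u₃ i 0 * Lax6 0 1 2 u₁ u₂ u₃ 0 2
    + Lax6 0 1 2 u₁ u₂ u₃ i 1 * Lax6 0 1 2 u₁ u₂ u₃ 1 2 - s • Lax6 0 1 2 u₁ u₂ u₃ i 2

theorem quad_zero_apply (u₁ u₂ u₃ s : ℂ) (p : P6) :
    quad u₁ u₂ u₃ s 0 p = X 1 * pderiv 1 (pderiv 1 p) + pderiv 2 (pderiv 0 p)
      + C (u₁ + 1 - s) * pderiv 1 p := by
  simp [quad, Lax6, Zm_apply, Dm_apply, pderiv_X, smul_eq_C_mul, C_two, pderiv_pderiv_comm 0 2]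
  ring

theorem quad_one_apply (u₁ u₂ u₃ s : ℂ) (p : P6) :
    quad u₁ u₂ u₃ s 1 p = X 1 * pderiv 2 (pderiv 1 p) + X 2 * pderiv 2 (pderiv 2 p)
      + C (u₂ + 1 - s) * pderiv 2 p - X 0 * quad u₁ u₂ u₃ s 0 p := by
  rw [quad_zero_apply]
  simp [quad, Lax6, Zm_apply, Dm_apply, pderiv_X, smul_eq_C_mul, pderiv_pderiv_comm 0 2]
  ring

theorem pderiv_quad_zero (u₁ u₂ u₃ s : ℂ) (p : P6) :
    pderiv 0 (quad u₁ u₂ u₃ s 0 p) = quad u₁ u₂ u₃ s 0 (pderiv 0 p) := by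
  simp [quad_zero_apply, pderiv_X, pderiv_pderiv_comm 0 1, pderiv_pderiv_comm 0 2]

theorem pderiv_quad_one (u₁ u₂ u₃ s : ℂ) (p : P6) :
    pderiv 0 (quad u₁ u₂ u₃ s 1 p) = quad u₁ u₂ u₃ s 1 (pderiv 0 p) - quad u₁ u₂ u₃ s 0 p := by
  simp [quad_one_apply, pderiv_X, pderiv_pderiv_comm 0 1, pderiv_pderiv_comm 0 2,
    pderiv_quad_zero]
  ring

theorem quad_zero_mul_lax (u₁ u₂ u₃ s : ℂ) :
    quad u₁ u₂ u₃ s 0 * Lax6 0 1 2 u₁ u₂ u₃ 1 0 =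
      Lax6 0 1 2 u₁ u₂ u₃ 1 0 * quad u₁ u₂ u₃ s 0 + quad u₁ u₂ u₃ s 1 := by
  refine LinearMap.ext fun p => ?_
  simp [quad_one_apply, quad_zero_apply, Lax6, Zm_apply, Dm_apply, pderiv_X, smul_eq_C_mul,
    pderiv_pderiv_comm 0 2, pderiv_pderiv_comm 0 1, pderiv_pderiv_comm 1 2]
  ring

theorem quad_one_mul_lax (u₁ u₂ u₃ s : ℂ) :
    quad u₁ u₂ u₃ s 1 * Lax6 0 1 2 u₁ u₂ u₃ 1 0 =
      Lax6 0 1 2 u₁ u₂ u₃ 1 0 * quad u₁ u₂ u₃ s 1 := by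
  refine LinearMap.ext fun p => ?_
  simp [quad_one_apply, quad_zero_apply, Lax6, Zm_apply, Dm_apply, pderiv_X, smul_eq_C_mul,
    pderiv_pderiv_comm 0 2, pderiv_pderiv_comm 0 1, pderiv_pderiv_comm 1 2]
  ring

theorem quad_mul_Zm (u₁ u₂ u₃ s : ℂ) (i : Fin 3) (j : Fin 6) (hj : 3 ≤ j) :
    quad u₁ u₂ u₃ s i * Zm j = Zm j * quad u₁ u₂ u₃ s i := by
  have h0 : (0 : Fin 6) ≠ j := by omega
  have h1 : (1 : Fin 6) ≠ j := by omega
  have h2 : (2 : Fin 6) ≠ j := by omega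
  refine LinearMap.ext fun p => ?_
  fin_cases i <;> simp [quad, Lax6, Zm_apply, Dm_apply, pderiv_X, smul_eq_C_mul, C_two,
    h0.symm, h1.symm, h2.symm] <;> ring

theorem restr_quad_zero (u₁ u₂ u₃ s : ℂ) (p : P6) :
    restr (quad u₁ u₂ u₃ s 0 p) = X 1 * pderiv 1 (pderiv 1 (restr p))
      + pderiv 2 (restr (pderiv 0 p)) + C (u₁ + 1 - s) * pderiv 1 (restr p) := by
  rw [quad_zero_apply]
  simp [restr_X, restr_pderiv]

theorem restr_quad_one (u₁ u₂ u₃ s : ℂ) (p : P6) :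
    restr (quad u₁ u₂ u₃ s 1 p) = X 1 * pderiv 2 (pderiv 1 (restr p))
      + X 2 * pderiv 2 (pderiv 2 (restr p)) + C (u₂ + 1 - s) * pderiv 2 (restr p) := by
  rw [quad_one_apply]
  simp [restr_X, restr_pderiv, restr_X_zero]

theorem quad_zero_mono (u₁ u₂ u₃ s : ℂ) (a c : ℕ) :
    quad u₁ u₂ u₃ s 0 (mono a 0 c) = C (a * c : ℂ) * mono (a - 1) 0 (c - 1) := by
  rw [quad_zero_apply, pderiv_one_mono, pderiv_zero_mono]
  simp [pderiv_two_mono]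
  ring

theorem quad_one_mono (u₁ u₂ u₃ s : ℂ) (a c : ℕ) :
    quad u₁ u₂ u₃ s 1 (mono a 0 c) = C (c * (c - a + u₂ - s) : ℂ) * mono a 0 (c - 1) := by
  rw [quad_one_apply, quad_zero_mono, pderiv_one_mono, pderiv_two_mono]
  rcases c with _ | c
  · simp
  · have h0 := X_mul_pderiv_zero_mono a 0 c
    have h2 := X_mul_pderiv_two_mono a 0 c
    rw [pderiv_zero_mono] at h0
    simp
    linear_combination (c + 1 : P6) * h2 - (c + 1 : P6) * h0

/-- The failure of `R` to intertwine `quad`. -/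
noncomputable def quadDefect (u₁ u₂ u₃ v₃ : ℂ) (R : E6) (i : Fin 3) : E6 :=
  quad u₁ u₂ v₃ u₃ i * R - R * quad u₁ u₂ u₃ v₃ i

section quadDefect

variable {u₁ u₂ u₃ v₃ : ℂ} {R : E6}

theorem quadDefect_apply (i : Fin 3) (p : P6) : quadDefect u₁ u₂ u₃ v₃ R i p =
    quad u₁ u₂ v₃ u₃ i (R p) - R (quad u₁ u₂ u₃ v₃ i p) := rfl

theorem Intertwines.natCast_mul_sym (hR : Intertwines u₁ u₂ u₃ v₃ R) (a b : ℕ) :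
    (a : P6) * sym R a b 0 = 0 := by
  rcases a with _ | a
  · simp
  · rw [hR.sym_eq_zero (a + 1) b 0 (by omega), mul_zero]

theorem Intertwines.restr_quadDefect_zero (hR : Intertwines u₁ u₂ u₃ v₃ R) (a c : ℕ) :
    restr (quadDefect u₁ u₂ u₃ v₃ R 0 (mono a 0 c)) = 0 := by
  have h : X 1 * (X 2 * restr (quadDefect u₁ u₂ u₃ v₃ R 0 (mono a 0 c))) = 0 := by
    rw [quadDefect_apply, map_sub, restr_quad_zero, quad_zero_mono, map_C_mul, map_mul, restr_C,
      hR.restr_pderiv_zero]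
    change X 1 * (X 2 * (X 1 * pderiv 1 (pderiv 1 (sym R a 0 c)) + _
      + _ * pderiv 1 (sym R a 0 c) - _ * sym R (a - 1) 0 (c - 1))) = 0
    have h1 := hR.X_mul_pderiv_one a 0 c
    have h2 := congrArg (pderiv 1) h1
    have h3 := hR.X_mul_pderiv_two (a - 1) 0 c
    simp only [Derivation.leibniz, pderiv_X_self, smul_eq_mul, Derivation.map_natCast,
      Nat.cast_zero, add_zero, map_sub, map_add, map_mul, map_one, map_natCast] at h1 h2 h3 ⊢
    rcases a with _ | a
    · simp only [Nat.cast_zero, zero_mul] at h1 h2 ⊢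
      linear_combination X 1 * X 2 * h2 + (C u₁ - C u₃) * X 2 * h1
    rcases c with _ | c
    · have h4 := hR.natCast_mul_sym a 0
      rw [hR.sym_eq_zero (a + 1) 0 0 (by omega)]
      simp only [Nat.add_sub_cancel, Nat.cast_zero, map_zero] at h3 ⊢
      linear_combination ((a + 1 : ℕ) : P6) * X 1 * h3 - ((a + 1 : ℕ) : P6) * X 1 * h4
    have h4 := hR.defect_eq_zero c a
    simp only [defect, Nat.add_sub_cancel, Nat.cast_add, Nat.cast_one, map_add, map_sub,
      map_one, map_natCast] at h1 h2 h3 h4 ⊢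
    linear_combination X 1 * X 2 * h2 + ((a : P6) + C u₁ + 1 - C u₃) * X 2 * h1
      + (a + 1 : P6) * X 1 * h3 + (a + 1 : P6) * h4
  exact (mul_eq_zero.1 ((mul_eq_zero.1 h).resolve_left (X_ne_zero 1))).resolve_left (X_ne_zero 2)

theorem Intertwines.restr_quadDefect_one (hR : Intertwines u₁ u₂ u₃ v₃ R) (a c : ℕ) :
    restr (quadDefect u₁ u₂ u₃ v₃ R 1 (mono a 0 c)) = 0 := by
  have h : X 2 * (X 2 * restr (quadDefect u₁ u₂ u₃ v₃ R 1 (mono a 0 c))) = 0 := by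
    rw [quadDefect_apply, map_sub, restr_quad_one, quad_one_mono, map_C_mul, map_mul, restr_C]
    change
      X 2 * (X 2 * (X 1 * pderiv 2 (pderiv 1 (sym R a 0 c)) + X 2 * pderiv 2 (pderiv 2 (sym R a 0 c))
      + _ * pderiv 2 (sym R a 0 c) - _ * sym R a 0 (c - 1))) = 0
    have h1 := congrArg (pderiv 2) (hR.X_mul_pderiv_one a 0 c)
    have h2 := hR.X_mul_pderiv_two a 0 c
    have h3 := congrArg (pderiv 2) h2
    simp only [Derivation.leibniz, pderiv_X_self, smul_eq_mul, Derivation.map_natCast,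
      Nat.cast_zero, add_zero, map_sub, map_add, map_mul, map_one, map_natCast] at h1 h2 h3 ⊢
    rw [pderiv_X_of_ne (by decide)] at h1
    rcases c with _ | c
    · have h4 := hR.natCast_mul_sym a 0
      simp only [Nat.cast_zero] at h1 h2 h3 ⊢
      linear_combination X 2 * X 2 * (h1 + h3) + X 2 * (C u₂ - C u₃) * h2
        - X 2 * (C u₂ - C u₃) * h4
    have h4 := hR.sym_two_one a c
    rcases a with _ | a
    · simp only [Nat.cast_zero, Nat.cast_add, Nat.add_sub_cancel, Nat.cast_one, map_sub, map_one,
        map_natCast, map_zero] at h1 h2 h3 h4 ⊢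
      linear_combination X 2 * X 2 * (h1 + h3) + X 2 * ((c : P6) + 1 + C u₂ - C u₃) * h2
        - (c + 1 : P6) * X 2 * h4
    have h5 := hR.sym_lower a c
    have h6 := hR.defect_eq_zero c a
    simp only [defect, Nat.add_sub_cancel, Nat.cast_add, Nat.cast_one, map_add, map_sub, map_one,
      map_natCast] at h1 h2 h3 h4 h5 h6 ⊢
    linear_combination X 2 * X 2 * (h1 + h3) + X 2 * ((c : P6) + 1 + C u₂ - C u₃) * h2
      - (c + 1 : P6) * X 2 * h4 - (a + 1 : P6) * (h5 + h6)
  exact (mul_eq_zero.1 ((mul_eq_zero.1 h).resolve_left (X_ne_zero 2))).resolve_left (X_ne_zero 2)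

theorem Intertwines.pderiv_quadDefect_zero (hR : Intertwines u₁ u₂ u₃ v₃ R) (p : P6) :
    pderiv 0 (quadDefect u₁ u₂ u₃ v₃ R 0 p) = quadDefect u₁ u₂ u₃ v₃ R 0 (pderiv 0 p) := by
  simp only [quadDefect_apply, map_sub, hR.pderiv_zero, ← pderiv_quad_zero]

theorem Intertwines.pderiv_quadDefect_one (hR : Intertwines u₁ u₂ u₃ v₃ R) (p : P6) :
    pderiv 0 (quadDefect u₁ u₂ u₃ v₃ R 1 p) =
      quadDefect u₁ u₂ u₃ v₃ R 1 (pderiv 0 p) - quadDefect u₁ u₂ u₃ v₃ R 0 p := by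
  simp only [quadDefect_apply, map_sub, pderiv_quad_one, hR.pderiv_zero,
    ← hR.pderiv_zero (quad _ _ _ _ _ _)]
  ring

theorem Intertwines.quadDefect_zero_lax (hR : Intertwines u₁ u₂ u₃ v₃ R) (p : P6) :
    quadDefect u₁ u₂ u₃ v₃ R 0 (Lax6 0 1 2 u₁ u₂ u₃ 1 0 p) =
      Lax6 0 1 2 u₁ u₂ v₃ 1 0 (quadDefect u₁ u₂ u₃ v₃ R 0 p) + quadDefect u₁ u₂ u₃ v₃ R 1 p := by
  have h1 := LinearMap.congr_fun (quad_zero_mul_lax u₁ u₂ u₃ v₃) p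
  have h2 := LinearMap.congr_fun (quad_zero_mul_lax u₁ u₂ v₃ u₃) (R p)
  simp only [Module.End.mul_apply, LinearMap.add_apply] at h1 h2
  simp only [quadDefect_apply, hR.apply 1 0 (by decide), h1, h2, map_add, map_sub]
  ring

theorem Intertwines.quadDefect_one_lax (hR : Intertwines u₁ u₂ u₃ v₃ R) (p : P6) :
    quadDefect u₁ u₂ u₃ v₃ R 1 (Lax6 0 1 2 u₁ u₂ u₃ 1 0 p) =
      Lax6 0 1 2 u₁ u₂ v₃ 1 0 (quadDefect u₁ u₂ u₃ v₃ R 1 p) := by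
  have h1 := LinearMap.congr_fun (quad_one_mul_lax u₁ u₂ u₃ v₃) p
  have h2 := LinearMap.congr_fun (quad_one_mul_lax u₁ u₂ v₃ u₃) (R p)
  simp only [Module.End.mul_apply] at h1 h2
  simp only [quadDefect_apply, hR.apply 1 0 (by decide), h1, h2, map_sub]


theorem Intertwines.quadDefect_zero_mono_zero (hR : Intertwines u₁ u₂ u₃ v₃ R) (a c : ℕ) :
    quadDefect u₁ u₂ u₃ v₃ R 0 (mono a 0 c) = 0 := by
  refine eq_zero_of_restr_of_pderiv _ (hR.restr_quadDefect_zero a c) ?_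
  induction a with
  | zero => rw [hR.pderiv_quadDefect_zero, pderiv_zero_mono]; simp
  | succ a ih =>
    rw [hR.pderiv_quadDefect_zero, pderiv_zero_mono, ← map_natCast C, map_C_mul,
      Nat.add_sub_cancel, eq_zero_of_restr_of_pderiv _ (hR.restr_quadDefect_zero a c) ih, mul_zero]

theorem Intertwines.quadDefect_one_mono_zero (hR : Intertwines u₁ u₂ u₃ v₃ R) (a c : ℕ) :
    quadDefect u₁ u₂ u₃ v₃ R 1 (mono a 0 c) = 0 := by
  refine eq_zero_of_restr_of_pderiv _ (hR.restr_quadDefect_one a c) ?_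
  induction a with
  | zero =>
    rw [hR.pderiv_quadDefect_one, hR.quadDefect_zero_mono_zero, pderiv_zero_mono]; simp
  | succ a ih =>
    rw [hR.pderiv_quadDefect_one, hR.quadDefect_zero_mono_zero, pderiv_zero_mono, ← map_natCast C,
      map_C_mul, Nat.add_sub_cancel,
      eq_zero_of_restr_of_pderiv _ (hR.restr_quadDefect_one a c) ih, mul_zero, sub_zero]

theorem Intertwines.quadDefect_mono (hR : Intertwines u₁ u₂ u₃ v₃ R) (b : ℕ) : ∀ a c : ℕ,
    quadDefect u₁ u₂ u₃ v₃ R 0 (mono a b c) = 0 ∧ quadDefect u₁ u₂ u₃ v₃ R 1 (mono a b c) = 0 := by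
  induction b with
  | zero => exact fun a c => ⟨hR.quadDefect_zero_mono_zero a c, hR.quadDefect_one_mono_zero a c⟩
  | succ b ih =>
    intro a c
    have hc : (C ((c + 1 : ℕ) : ℂ) : P6) ≠ 0 := C_ne_zero.2 (Nat.cast_ne_zero.2 (by omega))
    have h0 := hR.quadDefect_zero_lax (mono a b (c + 1))
    have h1 := hR.quadDefect_one_lax (mono a b (c + 1))
    rw [lax_one_zero_mono, map_add, map_C_mul, map_C_mul, Nat.add_sub_cancel] at h0 h1
    simp only [ih, map_zero, mul_zero, zero_add, mul_eq_zero, hc, false_or] at h0 h1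
    exact ⟨h0, h1⟩

theorem quadDefect_mul_Zm (i : Fin 3) (j : Fin 6) (hj : 3 ≤ j) (h : R * Zm j = Zm j * R) :
    quadDefect u₁ u₂ u₃ v₃ R i * Zm j = Zm j * quadDefect u₁ u₂ u₃ v₃ R i := by
  rw [quadDefect, sub_mul, mul_sub, mul_assoc, h, ← mul_assoc, quad_mul_Zm _ _ _ _ _ _ hj,
    mul_assoc R, quad_mul_Zm _ _ _ _ _ _ hj, ← mul_assoc R, h, mul_assoc, mul_assoc]

theorem eq_zero_of_mono (A : E6) (hA : ∀ j : Fin 6, 3 ≤ j → A * Zm j = Zm j * A)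
    (h : ∀ a b c, A (mono a b c) = 0) : A = 0 := by
  have hX (j : Fin 6) (hj : 3 ≤ j) (n : ℕ) (p : P6) (hp : A p = 0) : A (X j ^ n * p) = 0 := by
    induction n with
    | zero => simpa using hp
    | succ n ih =>
      have := LinearMap.congr_fun (hA j hj) (X j ^ n * p)
      simp only [Module.End.mul_apply, Zm_apply, ih, mul_zero] at this
      rw [pow_succ', mul_assoc, this]
  refine LinearMap.ext fun p => ?_
  rw [LinearMap.zero_apply]
  induction p using MvPolynomial.induction_on' with
  | add p q hp hq => rw [map_add, hp, hq, add_zero]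
  | monomial m t =>
    have hm : monomial m t =
        C t * (X 3 ^ m 3 * (X 4 ^ m 4 * (X 5 ^ m 5 * mono (m 0) (m 1) (m 2)))) := by
      rw [monomial_eq, Finsupp.prod_fintype _ _ (by simp), mono]
      simp only [Fin.prod_univ_six]
      ring
    rw [hm, map_C_mul, hX 3 (by decide), mul_zero]
    exact hX 4 (by decide) _ _ (hX 5 (by decide) _ _ (h _ _ _))

/-- The covector `(x₁z₁ + y₁, z₁, 1)` is a left eigenvector of the Lax matrix. -/
theorem lax_left_eigenvector (u₁ u₂ u₃ : ℂ) (j : Fin 3) (p : P6) :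
    (X 0 * X 2 + X 1) * Lax6 0 1 2 u₁ u₂ u₃ 0 j p + X 2 * Lax6 0 1 2 u₁ u₂ u₃ 1 j p
      + Lax6 0 1 2 u₁ u₂ u₃ 2 j p = C u₃ * ((![X 0 * X 2 + X 1, X 2, 1] : Fin 3 → P6) j * p) := by
  fin_cases j <;> simp [Lax6, Zm_apply, Dm_apply, smul_eq_C_mul, C_two] <;> ring

theorem Intertwines.quadDefect_two (hR : Intertwines u₁ u₂ u₃ v₃ R)
    (h22 : R * Lax6 0 1 2 u₁ u₂ u₃ 2 2 + v₃ • R = Lax6 0 1 2 u₁ u₂ v₃ 2 2 * R + u₃ • R)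
    (h0 : quadDefect u₁ u₂ u₃ v₃ R 0 = 0) (h1 : quadDefect u₁ u₂ u₃ v₃ R 1 = 0) :
    quadDefect u₁ u₂ u₃ v₃ R 2 = 0 := by
  refine LinearMap.ext fun p => ?_
  have e0 := LinearMap.congr_fun h0 p
  have e1 := LinearMap.congr_fun h1 p
  have e2 := LinearMap.congr_fun h22 p
  have k := lax_left_eigenvector u₁ u₂ v₃
  have k0 := k 0 (Lax6 0 1 2 u₁ u₂ v₃ 0 2 (R p) - R (Lax6 0 1 2 u₁ u₂ u₃ 0 2 p))
  have k1 := k 1 (Lax6 0 1 2 u₁ u₂ v₃ 1 2 (R p) - R (Lax6 0 1 2 u₁ u₂ u₃ 1 2 p))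
  have k2 := k 2 (R p)
  simp only [quadDefect_apply, quad, Module.End.mul_apply, LinearMap.add_apply,
    LinearMap.sub_apply, LinearMap.smul_apply, LinearMap.zero_apply, map_add, map_sub,
    smul_eq_C_mul, map_C_mul, hR.apply _ 0 (by decide), hR.apply _ 1 (by decide),
    Matrix.cons_val] at *
  linear_combination k0 + k1 + (C v₃ - C u₃) * k2 - (X 0 * X 2 + X 1) * e0 - X 2 * e1 + C v₃ * e2

theorem Intertwines.quadDefect_eq_zero (hR : Intertwines u₁ u₂ u₃ v₃ R)
    (hZ : ∀ j : Fin 6, 3 ≤ j → R * Zm j = Zm j * R)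
    (h22 : R * Lax6 0 1 2 u₁ u₂ u₃ 2 2 + v₃ • R = Lax6 0 1 2 u₁ u₂ v₃ 2 2 * R + u₃ • R)
    (i : Fin 3) : quadDefect u₁ u₂ u₃ v₃ R i = 0 := by
  have h0 : quadDefect u₁ u₂ u₃ v₃ R 0 = 0 :=
    eq_zero_of_mono _ (fun j hj => quadDefect_mul_Zm 0 j hj (hZ j hj))
      fun a b c => (hR.quadDefect_mono b a c).1
  have h1 : quadDefect u₁ u₂ u₃ v₃ R 1 = 0 :=
    eq_zero_of_mono _ (fun j hj => quadDefect_mul_Zm 1 j hj (hZ j hj))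
      fun a b c => (hR.quadDefect_mono b a c).2
  fin_cases i
  · exact h0
  · exact h1
  · exact hR.quadDefect_two h22 h0 h1

end quadDefect

theorem SM3_mul_frame (R : E6) (hx : R * Zm 3 = Zm 3 * R) (hy : R * Zm 4 = Zm 4 * R)
    (hz : R * Zm 5 = Zm 5 * R) : SM3 R * frame = frame * SM3 R := by
  ext i j : 1
  rw [SM3, Matrix.scalar_apply, Matrix.diagonal_mul, Matrix.mul_diagonal]
  fin_cases i <;> fin_cases j <;> simp [frame]
  · exact (Commute.neg_right hx).eq
  · exact (Commute.neg_right hy).eq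
  · exact (Commute.neg_right hz).eq

theorem SM3_mul_apply (R : E6) (M : Matrix (Fin 3) (Fin 3) E6) (i j : Fin 3) :
    (SM3 R * M) i j = R * M i j := by
  rw [SM3, Matrix.scalar_apply, Matrix.diagonal_mul]

theorem mul_SM3_apply (R : E6) (M : Matrix (Fin 3) (Fin 3) E6) (i j : Fin 3) :
    (M * SM3 R) i j = M i j * R := by
  rw [SM3, Matrix.scalar_apply, Matrix.mul_diagonal]

theorem SM3_mul_eq_iff (R : E6) (hx : R * Zm 3 = Zm 3 * R) (hy : R * Zm 4 = Zm 4 * R)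
    (hz : R * Zm 5 = Zm 5 * R) (A B : Matrix (Fin 3) (Fin 3) E6) :
    SM3 R * A = B * SM3 R ↔
      SM3 R * (frameInv * A * frame) = frameInv * B * frame * SM3 R := by
  have hF := SM3_mul_frame R hx hy hz
  have hG : SM3 R * frameInv = frameInv * SM3 R := by
    calc SM3 R * frameInv = frameInv * frame * (SM3 R * frameInv) := by
          rw [frameInv_mul_frame, one_mul]
      _ = frameInv * (frame * SM3 R) * frameInv := by simp only [mul_assoc]
      _ = frameInv * SM3 R * (frame * frameInv) := by rw [← hF]; simp only [mul_assoc]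
      _ = frameInv * SM3 R := by rw [frame_mul_frameInv, mul_one]
  have h1 : SM3 R * (frameInv * A * frame) = frameInv * (SM3 R * A) * frame := by
    rw [← mul_assoc, ← mul_assoc, hG, mul_assoc frameInv]
  have h2 : frameInv * B * frame * SM3 R = frameInv * (B * SM3 R) * frame := by
    rw [mul_assoc _ frame, ← hF]; simp only [mul_assoc]
  rw [h1, h2]
  refine ⟨fun h => by rw [h], fun h => ?_⟩
  have := congrArg (fun M => frame * M * frameInv) h
  simp only [mul_assoc, frame_mul_frameInv, mul_one] at this
  simpa only [← mul_assoc, frame_mul_frameInv, one_mul] using this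

theorem shiftConj_Zm_of_three_le (j : Fin 6) (hj : 3 ≤ j) : shiftConj (Zm j) = Zm j := by
  rw [shiftConj_Zm, shift_X]
  obtain rfl | rfl | rfl : j = 3 ∨ j = 4 ∨ j = 5 := by omega
  all_goals rfl

theorem mul_sum_eq_of_intertwine {A : Type*} [Ring A] [Algebra ℂ A]
    {T m₀ m₁ m₂ m₀' m₁' m₂' c₀ c₁ c₀' c₁' n₀ n₁ : A} {s t : ℂ}
    (h₀ : T * m₀ = m₀' * T) (h₁ : T * m₁ = m₁' * T)
    (l₀ : T * c₀ + T * n₀ = c₀' * T + n₀ * T) (l₁ : T * c₁ + T * n₁ = c₁' * T + n₁ * T)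
    (h : (m₀' * c₀' + m₁' * c₁' - t • m₂') * T - T * (m₀ * c₀ + m₁ * c₁ - s • m₂) = 0) :
    T * (m₀ * n₀ + m₁ * n₁ + m₂ * s • 1) = (m₀' * n₀ + m₁' * n₁ + m₂' * t • 1) * T := by
  rw [mul_smul_comm, mul_smul_comm, mul_one, mul_one]
  linear_combination (norm := noncomm_ring)
    h₀ * n₀ + h₀ * c₀ + h₁ * n₁ + h₁ * c₁ + m₀' * l₀ + m₁' * l₁ + h

theorem frameInv_mul_mul_frame (A B : Matrix (Fin 3) (Fin 3) E6) :
    frameInv * (A * B) * frame = (frameInv * A * frame) * (frameInv * B * frame) := by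
  calc frameInv * (A * B) * frame = frameInv * A * 1 * B * frame := by
        simp only [mul_one, mul_assoc]
    _ = _ := by rw [← frame_mul_frameInv]; simp only [mul_assoc]

/-- If `R` commutes with multiplication by `x₂`, `y₂`, `z₂`, commutes with
`∂_{x₁} − z₂∂_{y₁}`, and satisfies the first-order system
`R (L₁(u₁,u₂,u₃) + L₂(v₁,v₂,v₃)) = (L₁(u₁,u₂,v₃) + L₂(v₁,v₂,u₃)) R`, then it satisfies
the second-order defining equation
`R L₁(u₁,u₂,u₃) L₂(v₁,v₂,v₃) = L₁(u₁,u₂,v₃) L₂(v₁,v₂,u₃) R`. -/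
theorem sl3_R3_first_order_implies_second_order (u₁ u₂ u₃ v₁ v₂ v₃ : ℂ) (R : E6)
    (hx : R * Zm 3 = Zm 3 * R) (hy : R * Zm 4 = Zm 4 * R) (hz : R * Zm 5 = Zm 5 * R)
    (hd : R * (Dm 0 - Zm 5 * Dm 1) = (Dm 0 - Zm 5 * Dm 1) * R)
    (hL : SM3 R * (Lax6 0 1 2 u₁ u₂ u₃ + Lax6 3 4 5 v₁ v₂ v₃)
        = (Lax6 0 1 2 u₁ u₂ v₃ + Lax6 3 4 5 v₁ v₂ u₃) * SM3 R) :
    SM3 R * (Lax6 0 1 2 u₁ u₂ u₃ * Lax6 3 4 5 v₁ v₂ v₃)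
      = Lax6 0 1 2 u₁ u₂ v₃ * Lax6 3 4 5 v₁ v₂ u₃ * SM3 R := by
  rw [SM3_mul_eq_iff R hx hy hz] at hL ⊢
  simp only [frameInv_mul_mul_frame, mul_add, add_mul, frameInv_mul_lax_mul_frame,
    frameInv_mul_lax_mul_frame_first] at hL ⊢
  obtain ⟨S, rfl⟩ := shiftConj.surjective R
  have hL' (i j : Fin 3) : shiftConj S * shiftConj (Lax6 0 1 2 u₁ u₂ u₃ i j)
      + shiftConj S * laxTri v₁ v₂ v₃ i j =
      shiftConj (Lax6 0 1 2 u₁ u₂ v₃ i j) * shiftConj S + laxTri v₁ v₂ u₃ i j * shiftConj S := by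
    have := congrFun (congrFun hL i) j
    simpa only [Matrix.add_apply, SM3_mul_apply, mul_SM3_apply, Matrix.map_apply] using this
  have h01 : shiftConj S * laxTri v₁ v₂ v₃ 0 1 = laxTri v₁ v₂ u₃ 0 1 * shiftConj S := by
    have h := hL' 0 1
    have e (a : ℂ) : shiftConj (Lax6 0 1 2 u₁ u₂ a 0 1) = Dm 0 - Zm 5 * Dm 1 := shiftConj_Dm_zero
    rw [e, e, hd] at h
    exact add_left_cancel h
  have hcol (i j : Fin 3) (hj : j ≠ 2) :
      shiftConj S * laxTri v₁ v₂ v₃ i j = laxTri v₁ v₂ u₃ i j * shiftConj S := by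
    fin_cases j
    · fin_cases i <;> simp [laxTri]
    · fin_cases i
      · exact h01
      · simp [laxTri]
      · simp [laxTri]
    · exact absurd rfl hj
  have hS : Intertwines u₁ u₂ u₃ v₃ S := by
    intro i j hj
    apply shiftConj.injective
    rw [map_mul, map_mul]
    have h := hL' i j
    rw [hcol i j hj] at h
    exact add_right_cancel h
  have hZ (j : Fin 6) (hj : 3 ≤ j) : S * Zm j = Zm j * S := by
    apply shiftConj.injective
    rw [map_mul, map_mul, shiftConj_Zm_of_three_le j hj]
    obtain rfl | rfl | rfl : j = 3 ∨ j = 4 ∨ j = 5 := by omega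
    exacts [hx, hy, hz]
  have h22 : S * Lax6 0 1 2 u₁ u₂ u₃ 2 2 + v₃ • S = Lax6 0 1 2 u₁ u₂ v₃ 2 2 * S + u₃ • S := by
    apply shiftConj.injective
    rw [map_add, map_add, map_mul, map_mul, map_smul, map_smul]
    simpa [laxTri] using hL' 2 2
  ext i j : 1
  rw [SM3_mul_apply, mul_SM3_apply, Matrix.mul_apply, Matrix.mul_apply, Fin.sum_univ_three,
    Fin.sum_univ_three]
  simp only [Matrix.map_apply]
  have e0 := congrArg shiftConj (hS i 0 (by decide))
  have e1 := congrArg shiftConj (hS i 1 (by decide))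
  have e2 := congrArg shiftConj (hS.quadDefect_eq_zero hZ h22 i)
  have l0 := hL' 0 2
  have l1 := hL' 1 2
  simp only [quadDefect, quad, map_sub, map_add, map_mul, map_smul, map_zero] at e0 e1 e2
  by_cases hj : j = 2
  · subst hj
    exact mul_sum_eq_of_intertwine e0 e1 l0 l1 e2
  · have z (a₃ : ℂ) : laxTri v₁ v₂ a₃ 2 j = 0 := by
      obtain rfl | rfl : j = 0 ∨ j = 1 := by omega
      all_goals rfl
    rw [z, z, mul_zero, mul_zero, add_zero, add_zero, mul_add, add_mul, ← mul_assoc, ← mul_assoc,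
      e0, e1, mul_assoc, mul_assoc, hcol 0 j hj, hcol 1 j hj, mul_assoc, mul_assoc]
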